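/- The Tataru distance satisfies the completeness hypothesis of Ekeland's principle (Lemma A.2): Under the standing setting (complete geodesic metric space (E,d), proper lower semicontinuous energy 𝓔, an EVI_κ gradient flow S of 𝓔 on E), for any sequence (μₙ) in E with Σₙ d_T(μₙ₊₁, μₙ) < ∞ there exists ν ∈ E with limₙ d_T(ν, μₙ) = 0. -/

import Mathlib

open Filter Topology MeasureTheory
open scoped ENNReal

noncomputable section

/-- Upper right Dini derivative (EReal-valued). -/
def diniUR (φ : ℝ → ℝ) (t : ℝ) : EReal :=
  Filter.limsup (fun h : ℝ => (((φ (t + h) - φ t) / h : ℝ) : EReal)) (𝓝[>] (0 : ℝ))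

/-- A geodesic metric space: any two points are joined by a constant speed geodesic. -/
def GeodesicSpace (E : Type*) [MetricSpace E] : Prop :=
  ∀ ρ π : E, ∃ γ : ℝ → E, γ 0 = ρ ∧ γ 1 = π ∧
    ∀ s ∈ Set.Icc (0:ℝ) 1, ∀ t ∈ Set.Icc (0:ℝ) 1,
      dist (γ s) (γ t) = |t - s| * dist ρ π

/-- A continuous curve `γ : [0,∞) → E` with `γ((0,∞)) ⊆ D(𝓔)` solving the
evolution variational inequality EVI_κ. -/
def IsEVISolution {E : Type*} [MetricSpace E] (En : E → EReal) (κ : ℝ) (γ : ℝ → E) : Prop :=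
  ContinuousOn γ (Set.Ici (0:ℝ)) ∧
  (∀ t : ℝ, 0 < t → En (γ t) < ⊤) ∧
  ∀ ρ : E, En ρ < ⊤ → ∀ t : ℝ, 0 ≤ t →
    (1/2 : EReal) * diniUR (fun s => dist (γ s) ρ ^ 2) t ≤
      En ρ - En (γ t) - ((κ / 2 * dist (γ t) ρ ^ 2 : ℝ) : EReal)

/-- An EVI_κ gradient flow of `En` defined on all of `E`. -/
structure IsEVIFlow {E : Type*} [MetricSpace E] (En : E → EReal) (κ : ℝ) (S : ℝ → E → E) : Prop where
  cont : ∀ t : ℝ, 0 ≤ t → Continuous (S t)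
  id0 : ∀ π : E, S 0 π = π
  semigroup : ∀ (π : E) (s t : ℝ), 0 ≤ s → 0 ≤ t → S (t + s) π = S s (S t π)
  evi : ∀ π : E, IsEVISolution En κ (fun t => S t π)

open Classical in
/-- The local slope `|∂𝓔|(ρ)`. -/
def localSlope {E : Type*} [MetricSpace E] (En : E → EReal) (ρ : E) : ℝ≥0∞ :=
  if En ρ = ⊤ then ⊤
  else Filter.limsup (fun π : E => ENNReal.ofReal ((En ρ - En π).toReal / dist ρ π)) (𝓝[≠] ρ)

/-- The information functional `I = |∂𝓔|²`. -/
def info {E : Type*} [MetricSpace E] (En : E → EReal) (π : E) : ℝ≥0∞ := (localSlope En π) ^ 2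

/-- The (modified) Tataru distance `d_T(π,ρ) = inf_{t ≥ 0} { t + e^{κ̂ t} d(π, S(t)ρ) }`,
where `κ̂ = min κ 0`. -/
def tataru {E : Type*} [MetricSpace E] (S : ℝ → E → E) (κ : ℝ) (π ρ : E) : ℝ :=
  sInf {x : ℝ | ∃ t : ℝ, 0 ≤ t ∧ x = t + Real.exp (min κ 0 * t) * dist π (S t ρ)}

end

section EVI

theorem ContinuousOn.dist_curves {X E : Type*} [TopologicalSpace X] [PseudoMetricSpace E]
    {f g : X → E} {A : Set X} (hf : ContinuousOn f A) (hg : ContinuousOn g A) :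
    ContinuousOn (fun x => dist (f x) (g x)) A :=
  fun x hx => Filter.Tendsto.dist (hf x hx) (hg x hx)

variable {E : Type*} [MetricSpace E] {En : E → EReal} {κ : ℝ} {γ u v : ℝ → E}

theorem IsEVISolution.continuousAt (h : IsEVISolution En κ γ) {t : ℝ} (ht : 0 < t) :
    ContinuousAt γ t :=
  h.1.continuousAt (Ici_mem_nhds ht)

/-- The evolution variational inequality as an eventual bound on real difference quotients. -/
theorem IsEVISolution.eventually_slope_lt (h : IsEVISolution En κ γ) (hbot : ∀ π : E, En π ≠ ⊥)
    {ρ : E} (hρ : En ρ < ⊤) {t : ℝ} (ht : 0 < t) {r : ℝ}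
    (hr : 2 * ((En ρ).toReal - (En (γ t)).toReal) - κ * dist (γ t) ρ ^ 2 < r) :
    ∀ᶠ z in 𝓝[>] t, (z - t)⁻¹ * (dist (γ z) ρ ^ 2 - dist (γ t) ρ ^ 2) < r := by
  have hev := h.2.2 ρ hρ t ht.le
  rw [← EReal.coe_toReal hρ.ne (hbot ρ), ← EReal.coe_toReal (h.2.1 t ht).ne (hbot (γ t)),
    ← EReal.coe_sub, ← EReal.coe_sub] at hev
  have hhalf : (1 / 2 : EReal) = ((1 / 2 : ℝ) : EReal) := by
    rw [EReal.coe_div]; rfl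
  rw [hhalf] at hev
  have hlt : diniUR (fun s => dist (γ s) ρ ^ 2) t < (r : EReal) := by
    by_contra! hle
    have h1 : ((1 / 2 : ℝ) : EReal) * (r : EReal) ≤
        ((1 / 2 : ℝ) : EReal) * diniUR (fun s => dist (γ s) ρ ^ 2) t :=
      mul_le_mul_of_nonneg_left hle (by exact_mod_cast (by norm_num : (0 : ℝ) ≤ 1 / 2))
    have h2 := h1.trans hev
    rw [← EReal.coe_mul, EReal.coe_le_coe_iff] at h2
    linarith
  have hE := Filter.eventually_lt_of_limsup_lt hlt
  have hmap : Tendsto (fun z : ℝ => z - t) (𝓝[>] t) (𝓝[>] 0) := by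
    refine tendsto_nhdsWithin_iff.2 ⟨?_, ?_⟩
    · have : Tendsto (fun z : ℝ => z - t) (𝓝 t) (𝓝 (t - t)) :=
        tendsto_id.sub_const t
      rw [sub_self] at this
      exact this.mono_left nhdsWithin_le_nhds
    · filter_upwards [self_mem_nhdsWithin] with z hz
      exact sub_pos.2 (Set.mem_Ioi.1 hz)
  filter_upwards [hmap.eventually hE] with z hz
  have hz' := EReal.coe_lt_coe_iff.1 hz
  rw [add_sub_cancel] at hz'
  rwa [inv_mul_eq_div]

/-- The energy is nonincreasing along solutions of the evolution variational inequality. -/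
theorem IsEVISolution.energy_antitone (h : IsEVISolution En κ γ) (hbot : ∀ π : E, En π ≠ ⊥)
    (hlsc : LowerSemicontinuous En) {s t : ℝ} (hs : 0 < s) (hst : s ≤ t) :
    En (γ t) ≤ En (γ s) := by
  by_contra! hlt
  have hcont : ContinuousOn γ (Set.Icc s t) :=
    h.1.mono fun r hr => hs.le.trans hr.1
  have hcpt : IsCompact (Set.Icc s t ∩ γ ⁻¹' (En ⁻¹' Set.Iic (En (γ s)))) :=
    isCompact_Icc.of_isClosed_subset
      (hcont.preimage_isClosed_of_isClosed isClosed_Icc (hlsc.isClosed_preimage _))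
      Set.inter_subset_left
  obtain ⟨x, ⟨⟨hsx, hxt⟩, hx⟩, hmax⟩ :=
    hcpt.exists_isGreatest ⟨s, ⟨le_rfl, hst⟩, le_refl (En (γ s))⟩
  have hx' : En (γ x) ≤ En (γ s) := hx
  have hx0 : 0 < x := hs.trans_le hsx
  have hle : ∀ r ∈ Set.Ico x t, (En (γ x)).toReal ≤ (En (γ r)).toReal := by
    intro r hr
    refine EReal.toReal_le_toReal ?_ (hbot _) (h.2.1 r (hx0.trans_le hr.1)).ne
    by_contra! hrx
    have hrm : r ≤ x := hmax ⟨⟨hsx.trans hr.1, hr.2.le⟩, hrx.le.trans hx'⟩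
    rw [le_antisymm hrm hr.1] at hrx
    exact lt_irrefl _ hrx
  have hgr := le_gronwallBound_of_liminf_deriv_right_le
    (f := fun r => dist (γ r) (γ x) ^ 2) (f' := fun r => -κ * dist (γ r) (γ x) ^ 2)
    (δ := 0) (K := -κ) (ε := 0) (a := x) (b := t)
    ((ContinuousOn.dist_curves (hcont.mono (Set.Icc_subset_Icc_left hsx)) continuousOn_const).pow 2)
    (fun r hr q hq => (h.eventually_slope_lt hbot (h.2.1 x hx0) (hx0.trans_le hr.1)
      (by linarith [hle r hr])).frequently)
    (by simp) (fun r _ => by simp) t ⟨hxt, le_rfl⟩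
  rw [gronwallBound_ε0_δ0] at hgr
  have hd : dist (γ t) (γ x) = 0 := by
    have := sq_nonneg (dist (γ t) (γ x))
    exact pow_eq_zero_iff (two_ne_zero) |>.1 (le_antisymm hgr this)
  rw [dist_eq_zero.1 hd] at hlt
  exact absurd hx' hlt.not_ge

theorem IsEVISolution.eventually_slope_dist_sq_lt (hu : IsEVISolution En κ u)
    (hv : IsEVISolution En κ v) (hbot : ∀ π : E, En π ≠ ⊥) (hlsc : LowerSemicontinuous En)
    {t : ℝ} (ht : 0 < t) {r : ℝ} (hr : -(2 * κ) * dist (u t) (v t) ^ 2 < r) :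
    ∀ᶠ z in 𝓝[>] t, (z - t)⁻¹ * (dist (u z) (v z) ^ 2 - dist (u t) (v t) ^ 2) < r := by
  obtain ⟨ε, hε, hεr⟩ : ∃ ε > 0, -(2 * κ) * dist (u t) (v t) ^ 2 + 4 * ε = r :=
    ⟨(r - -(2 * κ) * dist (u t) (v t) ^ 2) / 4, by linarith, by ring⟩
  have hsecond := hv.eventually_slope_lt hbot (hu.2.1 t ht) ht
    (lt_add_of_pos_right _ hε)
  have henergy : ∀ᶠ w in 𝓝 t, (((En (u t)).toReal - ε : ℝ) : EReal) < En (u w) := by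
    refine (hu.continuousAt ht).eventually (hlsc (u t) _ ?_)
    change (((En (u t)).toReal - ε : ℝ) : EReal) < En (u t)
    conv_rhs => rw [← EReal.coe_toReal (hu.2.1 t ht).ne (hbot (u t))]
    exact EReal.coe_lt_coe_iff.2 (sub_lt_self _ hε)
  have hdist : ∀ᶠ p : ℝ × ℝ in 𝓝 t ×ˢ 𝓝 t,
      κ * dist (u t) (v t) ^ 2 - ε < κ * dist (u p.1) (v p.2) ^ 2 := by
    have hc : Tendsto (fun p : ℝ × ℝ => κ * dist (u p.1) (v p.2) ^ 2) (𝓝 t ×ˢ 𝓝 t)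
        (𝓝 (κ * dist (u t) (v t) ^ 2)) :=
      ((((hu.continuousAt ht).tendsto.comp tendsto_fst).dist
        ((hv.continuousAt ht).tendsto.comp tendsto_snd)).pow 2).const_mul κ
    exact hc.eventually_const_lt (by linarith)
  obtain ⟨δ₁, hδ₁, hE⟩ := Metric.eventually_nhds_iff.1 henergy
  rw [← nhds_prod_eq] at hdist
  obtain ⟨δ₂, hδ₂, hD⟩ := Metric.eventually_nhds_iff.1 hdist
  have hnear : ∀ᶠ z in 𝓝[>] t, z < t + min δ₁ δ₂ :=
    (eventually_lt_nhds (by linarith [lt_min hδ₁ hδ₂])).filter_mono nhdsWithin_le_nhds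
  filter_upwards [hsecond, hnear, self_mem_nhdsWithin] with z hz hzδ htz
  have htz : t < z := htz
  have hz₁ : z < t + δ₁ := hzδ.trans_le (by gcongr; exact min_le_left _ _)
  have hz₂ : z < t + δ₂ := hzδ.trans_le (by gcongr; exact min_le_right _ _)
  have hz0 : 0 < z := ht.trans htz
  have hvz : (En (v z)).toReal ≤ (En (v t)).toReal :=
    EReal.toReal_le_toReal (hv.energy_antitone hbot hlsc ht htz.le) (hbot _) (hv.2.1 t ht).ne
  have hfirst := le_gronwallBound_of_liminf_deriv_right_le
    (f := fun w => dist (u w) (v z) ^ 2)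
    (f' := fun _ => 2 * ((En (v t)).toReal - (En (u t)).toReal) - κ * dist (u t) (v t) ^ 2 + 3 * ε)
    (δ := dist (u t) (v z) ^ 2) (K := 0)
    (ε := 2 * ((En (v t)).toReal - (En (u t)).toReal) - κ * dist (u t) (v t) ^ 2 + 3 * ε)
    (a := t) (b := z)
    ((ContinuousOn.dist_curves (hu.1.mono fun w hw => ht.le.trans hw.1) continuousOn_const).pow 2)
    (fun w hw q hq => by
      have hw0 : 0 < w := ht.trans_le hw.1
      refine (hu.eventually_slope_lt hbot (hv.2.1 z hz0) hw0 (lt_of_le_of_lt ?_ hq)).frequently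
      have h1 : (En (u t)).toReal - ε < (En (u w)).toReal := by
        have := hE (y := w) (by rw [Real.dist_eq, abs_lt]; constructor <;> linarith [hw.1, hw.2])
        rwa [← EReal.coe_toReal (hu.2.1 w hw0).ne (hbot (u w)), EReal.coe_lt_coe_iff] at this
      have h2 := hD (y := (w, z)) (by
        rw [Prod.dist_eq, max_lt_iff, Real.dist_eq, Real.dist_eq, abs_lt, abs_lt]
        refine ⟨⟨?_, ?_⟩, ?_, ?_⟩ <;> simp only <;> linarith [hw.1, hw.2])
      simp only at h2
      linarith)
    le_rfl (fun _ _ => by simp) z ⟨htz.le, le_rfl⟩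
  rw [gronwallBound_K0] at hfirst
  simp only at hfirst
  have hpos : 0 < z - t := sub_pos.2 htz
  rw [inv_mul_eq_div, div_lt_iff₀ hpos] at hz ⊢
  rw [dist_comm (v z), dist_comm (v t)] at hz
  rw [← hεr]
  linarith

/-- Two solutions of the evolution variational inequality satisfy the `κ`-contraction estimate. -/
theorem IsEVISolution.dist_le (hu : IsEVISolution En κ u)
    (hv : IsEVISolution En κ v) (hbot : ∀ π : E, En π ≠ ⊥) (hlsc : LowerSemicontinuous En)
    {t : ℝ} (ht : 0 ≤ t) :
    dist (u t) (v t) ≤ Real.exp (-κ * t) * dist (u 0) (v 0) := by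
  rcases ht.eq_or_lt with rfl | ht
  · simp
  have hpos : ∀ s ∈ Set.Ioo 0 t,
      dist (u t) (v t) ^ 2 ≤ dist (u s) (v s) ^ 2 * Real.exp (-(2 * κ) * (t - s)) := by
    intro s hs
    have hsub : Set.Icc s t ⊆ Set.Ici 0 := fun w hw => hs.1.le.trans hw.1
    have := le_gronwallBound_of_liminf_deriv_right_le
      (f := fun w => dist (u w) (v w) ^ 2) (f' := fun w => -(2 * κ) * dist (u w) (v w) ^ 2)
      (δ := dist (u s) (v s) ^ 2) (K := -(2 * κ)) (ε := 0) (a := s) (b := t)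
      ((ContinuousOn.dist_curves (hu.1.mono hsub) (hv.1.mono hsub)).pow 2)
      (fun w hw q hq => (hu.eventually_slope_dist_sq_lt hv hbot hlsc
        (hs.1.trans_le hw.1) hq).frequently)
      le_rfl (fun _ _ => by simp) t ⟨hs.2.le, le_rfl⟩
    rwa [gronwallBound_ε0] at this
  have hlim : Tendsto (fun s => dist (u s) (v s) ^ 2 * Real.exp (-(2 * κ) * (t - s))) (𝓝[>] 0)
      (𝓝 (dist (u 0) (v 0) ^ 2 * Real.exp (-(2 * κ) * (t - 0)))) := by
    have hc : ContinuousOn (fun s => dist (u s) (v s) ^ 2 * Real.exp (-(2 * κ) * (t - s)))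
        (Set.Ici 0) :=
      ((ContinuousOn.dist_curves hu.1 hv.1).pow 2).mul (by fun_prop)
    exact (hc 0 Set.self_mem_Ici).mono_left (nhdsWithin_mono _ Set.Ioi_subset_Ici_self)
  have hsq := ge_of_tendsto hlim (Filter.mem_of_superset (Ioo_mem_nhdsGT ht) hpos)
  refine le_of_sq_le_sq ?_ (by positivity)
  calc _ ≤ _ := hsq
    _ = _ := by
      rw [mul_pow, ← Real.exp_nat_mul, mul_comm]
      congr 2
      push_cast
      ring

end EVI

section Tataru

variable {E : Type*} [MetricSpace E] {S : ℝ → E → E} {κ : ℝ}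

theorem tataru_nonneg (π ρ : E) : 0 ≤ tataru S κ π ρ :=
  Real.sInf_nonneg (by rintro x ⟨t, ht, rfl⟩; positivity)

theorem tataru_le (π ρ : E) {t : ℝ} (ht : 0 ≤ t) :
    tataru S κ π ρ ≤ t + Real.exp (min κ 0 * t) * dist π (S t ρ) :=
  csInf_le ⟨0, by rintro x ⟨t, ht, rfl⟩; positivity⟩ ⟨t, ht, rfl⟩

theorem exists_lt_of_tataru_lt {π ρ : E} {a : ℝ} (h : tataru S κ π ρ < a) :
    ∃ t : ℝ, 0 ≤ t ∧ t + Real.exp (min κ 0 * t) * dist π (S t ρ) < a := by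
  obtain ⟨x, ⟨t, ht, rfl⟩, hx⟩ := exists_lt_of_csInf_lt (by exact ⟨_, 0, le_rfl, rfl⟩) h
  exact ⟨t, ht, hx⟩

end Tataru

/-- The Tataru distance satisfies the completeness hypothesis of Ekeland's principle (Lemma A.2). -/
theorem tataru_ekeland_completeness
    {E : Type*} [MetricSpace E] [CompleteSpace E]
    (hgeo : GeodesicSpace E)
    (En : E → EReal) (hbot : ∀ π : E, En π ≠ ⊥) (hproper : ∃ π : E, En π < ⊤)
    (hlsc : LowerSemicontinuous En)
    (κ : ℝ) (S : ℝ → E → E) (hflow : IsEVIFlow En κ S)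
    (μ : ℕ → E) (hsum : Summable (fun n => tataru S κ (μ (n + 1)) (μ n))) :
    ∃ ν : E, Filter.Tendsto (fun n => tataru S κ ν (μ n)) Filter.atTop (𝓝 0) := by
  have hcontr : ∀ (π ρ : E) (t : ℝ), 0 ≤ t →
      dist (S t π) (S t ρ) ≤ Real.exp (-min κ 0 * t) * dist π ρ := by
    intro π ρ t ht
    have h := (hflow.evi π).dist_le (hflow.evi ρ) hbot hlsc ht
    simp only [hflow.id0] at h
    refine h.trans ?_
    gcongr
    exact min_le_left _ _
  have hlt : ∀ n, tataru S κ (μ (n + 1)) (μ n) <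
      tataru S κ (μ (n + 1)) (μ n) + (1 / 2 : ℝ) ^ n := fun n =>
    lt_add_of_pos_right _ (by positivity)
  choose t ht0 ht using fun n => exists_lt_of_tataru_lt (hlt n)
  set ε : ℕ → ℝ := fun n => tataru S κ (μ (n + 1)) (μ n) + (1 / 2 : ℝ) ^ n with hε
  have hεsum : Summable ε := hsum.add summable_geometric_two
  have htsum : Summable t := hεsum.of_nonneg_of_le ht0 fun n =>
    (le_add_of_nonneg_right (by positivity)).trans (ht n).le
  set T : ℕ → ℝ := fun n => ∑' k, t (k + n) with hT
  have hT0 : ∀ n, 0 ≤ T n := fun n => tsum_nonneg fun k => ht0 _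
  have hTlim : Tendsto T atTop (𝓝 0) := tendsto_sum_nat_add t
  have hTsucc : ∀ n, T n = t n + T (n + 1) := by
    intro n
    have h := ((summable_nat_add_iff n).2 htsum).tsum_eq_zero_add
    simp only [hT, h, zero_add]
    congr 2
    ext k
    congr 1
    ring
  have hTle : ∀ n, T n ≤ T 0 := by
    intro n
    induction n with
    | zero => exact le_rfl
    | succ n ih => linarith [hTsucc n, ht0 n]
  have hκ : 0 ≤ -min κ 0 := neg_nonneg.2 (min_le_right _ _)
  have hdist : ∀ n, dist (μ (n + 1)) (S (t n) (μ n)) ≤ Real.exp (-min κ 0 * T 0) * ε n := by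
    intro n
    have h1 : Real.exp (min κ 0 * t n) * dist (μ (n + 1)) (S (t n) (μ n)) ≤ ε n := by
      linarith [ht n, ht0 n]
    have h2 : t n ≤ T 0 := by linarith [hTsucc n, hT0 (n + 1), hTle n]
    calc dist (μ (n + 1)) (S (t n) (μ n))
        = Real.exp (-min κ 0 * t n) *
            (Real.exp (min κ 0 * t n) * dist (μ (n + 1)) (S (t n) (μ n))) := by
          rw [← mul_assoc, ← Real.exp_add]
          simp
      _ ≤ Real.exp (-min κ 0 * T 0) * ε n := by gcongr
  have hstep : ∀ n, dist (S (T n) (μ n)) (S (T (n + 1)) (μ (n + 1))) ≤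
      Real.exp (-min κ 0 * T 0) * (Real.exp (-min κ 0 * T 0) * ε n) := by
    intro n
    rw [hTsucc n, hflow.semigroup _ _ _ (hT0 _) (ht0 n), dist_comm]
    refine (hcontr _ _ _ (hT0 _)).trans ?_
    gcongr
    · exact hTle _
    · exact hdist n
  obtain ⟨ν, hν⟩ := cauchySeq_tendsto_of_complete
    (cauchySeq_of_dist_le_of_summable _ hstep ((hεsum.mul_left _).mul_left _))
  refine ⟨ν, squeeze_zero (fun n => tataru_nonneg _ _)
    (g := fun n => T n + dist ν (S (T n) (μ n))) (fun n => ?_) ?_⟩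
  · refine (tataru_le _ _ (hT0 n)).trans ?_
    gcongr
    refine mul_le_of_le_one_left dist_nonneg (Real.exp_le_one_iff.2 ?_)
    exact mul_nonpos_of_nonpos_of_nonneg (min_le_right _ _) (hT0 n)
  · simpa using hTlim.add ((tendsto_const_nhds (x := ν)).dist hν)
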